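/- Relation between bounded-communication purity and common randomness distillation: Let ρ^{XB} be a classical-quantum state with purification on XBE. For n ≥ 1 define P_n(R) = max_{Y|X^n} { (1/n) I(Y;B^n) : (1/n) I(Y;B^nE^n) ≤ R } and D_n(R) = max_{Y|X^n} { (1/n) I(Y;B^n) : (1/n)(I(Y;X^n) − I(Y;B^n)) ≤ R }, the maxima over classical channels Y|X^n applied to the classical system X^n of (ρ^{XB})^{⊗n}. Then for all R ≥ 0 and all n, P_n(D_n(R) + R) = D_n(R). -/

import Mathlib

noncomputable section
namespace LPD

open Matrix Kronecker BigOperators Filter Finset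
open scoped ComplexOrder

/-- The positive semidefinite square root of a positive semidefinite matrix
(the definition of the older Mathlib, which has since been removed). -/
def _root_.Matrix.PosSemidef.sqrt {n 𝕜 : Type*} [Fintype n] [RCLike 𝕜] [DecidableEq n]
    {A : Matrix n n 𝕜} (hA : A.PosSemidef) : Matrix n n 𝕜 :=
  hA.1.eigenvectorUnitary.1 * diagonal ((↑) ∘ Real.sqrt ∘ hA.1.eigenvalues) *
    (star hA.1.eigenvectorUnitary : Matrix n n 𝕜)

/-- The trace norm `‖ω‖₁ = Tr √(ωᴴ ω)` of a matrix. -/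
def traceNorm {ι : Type*} [Fintype ι] [DecidableEq ι] (ω : Matrix ι ι ℂ) : ℝ :=
  ((Matrix.posSemidef_conjTranspose_mul_self ω).sqrt).trace.re

/-- A density operator: positive semidefinite with trace one. -/
def IsDensity {ι : Type*} [Fintype ι] (ρ : Matrix ι ι ℂ) : Prop :=
  ρ.PosSemidef ∧ ρ.trace = 1

/-- The von Neumann entropy `H(ρ) = -Tr(ρ log ρ)`, expressed via eigenvalues
(with the convention `0 log 0 = 0`, and junk value `0` on non-Hermitian input). -/
def entropy {ι : Type*} [Fintype ι] [DecidableEq ι] (ρ : Matrix ι ι ℂ) : ℝ :=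
  letI := Classical.dec ρ.IsHermitian
  if h : ρ.IsHermitian then -∑ i, h.eigenvalues i * Real.log (h.eigenvalues i) else 0

/-- Partial trace over the first (left) tensor factor. -/
def ptraceLeft {α β : Type*} [Fintype α] (ρ : Matrix (α × β) (α × β) ℂ) : Matrix β β ℂ :=
  fun b b' => ∑ a, ρ (a, b) (a, b')

/-- Partial trace over the second (right) tensor factor. -/
def ptraceRight {α β : Type*} [Fintype β] (ρ : Matrix (α × β) (α × β) ℂ) : Matrix α α ℂ :=
  fun a a' => ∑ b, ρ (a, b) (a', b)

/-- Quantum mutual information `I(A;B) = H(A) + H(B) - H(AB)` of a bipartite state. -/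
def mutualInfo {α β : Type*} [Fintype α] [DecidableEq α] [Fintype β] [DecidableEq β]
    (ρ : Matrix (α × β) (α × β) ℂ) : ℝ :=
  entropy (ptraceRight ρ) + entropy (ptraceLeft ρ) - entropy ρ

/-- Conditional entropy `H(B|A) = H(AB) - H(A)` (second system conditioned on the first). -/
def condEntropySnd {α β : Type*} [Fintype α] [DecidableEq α] [Fintype β] [DecidableEq β]
    (ρ : Matrix (α × β) (α × β) ℂ) : ℝ :=
  entropy ρ - entropy (ptraceRight ρ)

/-- Conditional entropy `H(A|B) = H(AB) - H(B)` (first system conditioned on the second). -/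
def condEntropyFst {α β : Type*} [Fintype α] [DecidableEq α] [Fintype β] [DecidableEq β]
    (ρ : Matrix (α × β) (α × β) ℂ) : ℝ :=
  entropy ρ - entropy (ptraceLeft ρ)

/-- `n`-fold tensor power of a matrix. -/
def tpow {ι : Type*} (ρ : Matrix ι ι ℂ) (n : ℕ) : Matrix (Fin n → ι) (Fin n → ι) ℂ :=
  fun x y => ∏ k, ρ (x k) (y k)

/-- `n`-fold tensor power of a bipartite state, with the `A` and `B` factors collected. -/
def tpowAB {α β : Type*} (ρ : Matrix (α × β) (α × β) ℂ) (n : ℕ) :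
    Matrix ((Fin n → α) × (Fin n → β)) ((Fin n → α) × (Fin n → β)) ℂ :=
  Matrix.reindex (Equiv.arrowProdEquivProdArrow (Fin n) (fun _ => α) (fun _ => β))
    (Equiv.arrowProdEquivProdArrow (Fin n) (fun _ => α) (fun _ => β)) (tpow ρ n)

/-- A POVM on the system `ι` with outcome set `κ`. -/
structure POVM (ι κ : Type*) [Fintype ι] [DecidableEq ι] [Fintype κ] where
  elem : κ → Matrix ι ι ℂ
  pos : ∀ y, (elem y).PosSemidef
  sum_eq : ∑ y, elem y = 1

/-- Apply a POVM to the first factor of a bipartite state, recording the outcome in a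
classical register: `ρ^{AΓ} ↦ Σ_y |y⟩⟨y| ⊗ Tr_A((Λ_y ⊗ 1)ρ)`. -/
def measureLeft {ι κ γ : Type*} [Fintype ι] [DecidableEq ι] [Fintype κ] [DecidableEq κ]
    (Λ : POVM ι κ) (ρ : Matrix (ι × γ) (ι × γ) ℂ) : Matrix (κ × γ) (κ × γ) ℂ :=
  fun p q => if p.1 = q.1 then ∑ a, ∑ a', (Λ.elem p.1) a a' * ρ (a', p.2) (a, q.2) else 0

/-- The canonical purification of a density operator `ρ` on `ι`, a pure state on `ι × ι`
(junk value `0` for non-positive-semidefinite input). -/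
def canonicalPurification {ι : Type*} [Fintype ι] [DecidableEq ι] (ρ : Matrix ι ι ℂ) :
    Matrix (ι × ι) (ι × ι) ℂ :=
  letI := Classical.dec ρ.PosSemidef
  if h : ρ.PosSemidef then
    vecMulVec (fun p => h.sqrt p.1 p.2) (star fun p => h.sqrt p.1 p.2)
  else 0

/-- The purity `κ(ρ) = log d - H(ρ)`. -/
def kappa {ι : Type*} [Fintype ι] [DecidableEq ι] (ρ : Matrix ι ι ℂ) : ℝ :=
  Real.log (Fintype.card ι) - entropy ρ

/-- The pure state `|0⟩⟨0|` on a `d`-dimensional system. -/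
def pureZero (d : ℕ) : Matrix (Fin d) (Fin d) ℂ :=
  fun i j => if i.val = 0 ∧ j.val = 0 then 1 else 0

/-! ### Index bookkeeping equivalences -/

/-- `(a × b) × c ≃ (a × c) × b`. -/
def swapE (a b c : Type*) : (a × b) × c ≃ (a × c) × b where
  toFun x := ((x.1.1, x.2), x.1.2)
  invFun x := ((x.1.1, x.2), x.1.2)
  left_inv _ := rfl
  right_inv _ := rfl

/-- Pull the `Y` register to the front: `((a × y) × g) × b ≃ y × ((a × g) × b)`. -/
def pullY (a y g b : Type*) : ((a × y) × g) × b ≃ y × ((a × g) × b) where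
  toFun x := (x.1.1.2, ((x.1.1.1, x.1.2), x.2))
  invFun x := (((x.2.1.1, x.1), x.2.1.2), x.2.2)
  left_inv _ := rfl
  right_inv _ := rfl

/-- Rearrange for Bob's unitary: `((a × y) × g) × b ≃ (b × y) × (a × g)`. -/
def pullBY (a y g b : Type*) : ((a × y) × g) × b ≃ (b × y) × (a × g) where
  toFun x := ((x.2, x.1.1.2), (x.1.1.1, x.1.2))
  invFun x := (((x.2.1, x.1.2), x.2.2), x.1.1)
  left_inv _ := rfl
  right_inv _ := rfl

/-- Collect `Y` and `B` together: `((a × y) × g) × b ≃ (y × b) × (a × g)`. -/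
def pullYB (a y g b : Type*) : ((a × y) × g) × b ≃ (y × b) × (a × g) where
  toFun x := ((x.1.1.2, x.2), (x.1.1.1, x.1.2))
  invFun x := (((x.2.1, x.1.1), x.2.2), x.1.2)
  left_inv _ := rfl
  right_inv _ := rfl

/-- Sort output registers: `(bp × bg) × (ap × ag) ≃ (ap × bp) × (ag × bg)`. -/
def sortOut (bp bg ap ag : Type*) : (bp × bg) × (ap × ag) ≃ (ap × bp) × (ag × bg) where
  toFun x := ((x.2.1, x.1.1), (x.2.2, x.1.2))
  invFun x := ((x.1.2, x.2.2), (x.1.1, x.2.1))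
  left_inv _ := rfl
  right_inv _ := rfl

/-- `y × (x × w) ≃ (y × w) × x`. -/
def exYW (y x w : Type*) : y × (x × w) ≃ (y × w) × x where
  toFun a := ((a.1, a.2.2), a.2.1)
  invFun a := (a.1.1, (a.2, a.1.2))
  left_inv _ := rfl
  right_inv _ := rfl

/-- `y × (x × w) ≃ (y × x) × w`. -/
def exYX (y x w : Type*) : y × (x × w) ≃ (y × x) × w where
  toFun a := ((a.1, a.2.1), a.2.2)
  invFun a := (a.1.1, (a.1.2, a.2))
  left_inv _ := rfl
  right_inv _ := rfl

/-- `y × (x × (b × e)) ≃ (y × b) × (x × e)`. -/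
def exYB (y x b e : Type*) : y × (x × (b × e)) ≃ (y × b) × (x × e) where
  toFun a := ((a.1, a.2.2.1), (a.2.1, a.2.2.2))
  invFun a := (a.1.1, (a.2.1, (a.1.2, a.2.2)))
  left_inv _ := rfl
  right_inv _ := rfl

/-! ### The state `σ^{YBE}` obtained by measuring Alice's share of a purification -/

/-- The canonical purification of a bipartite state `ρ^{AB}`, with indices arranged as
`A × (B × E)` where `E = A × B`. -/
def purifyAssoc {α β : Type*} [Fintype α] [DecidableEq α] [Fintype β] [DecidableEq β]
    (ρ : Matrix (α × β) (α × β) ℂ) :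
    Matrix (α × (β × (α × β))) (α × (β × (α × β))) ℂ :=
  Matrix.reindex (Equiv.prodAssoc α β (α × β)) (Equiv.prodAssoc α β (α × β))
    (canonicalPurification ρ)

/-- `σ^{YBE} = (Λ ⊗ 1^{BE})(Ψ^{ABE})` for the canonical purification `Ψ` of `ρ^{AB}`. -/
def sigmaOf {α β κ : Type*} [Fintype α] [DecidableEq α] [Fintype β] [DecidableEq β]
    [Fintype κ] [DecidableEq κ] (ρ : Matrix (α × β) (α × β) ℂ) (Λ : POVM α κ) :
    Matrix (κ × (β × (α × β))) (κ × (β × (α × β))) ℂ :=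
  measureLeft Λ (purifyAssoc ρ)

/-- `I(Y;B)` evaluated on a state of the form `σ^{Y(BE)}`: trace out `E`, then take the
mutual information. -/
def IYB {κ β ε : Type*} [Fintype κ] [DecidableEq κ] [Fintype β] [DecidableEq β] [Fintype ε]
    (σ : Matrix (κ × (β × ε)) (κ × (β × ε)) ℂ) : ℝ :=
  mutualInfo (ptraceRight (Matrix.reindex (Equiv.prodAssoc κ β ε).symm
    (Equiv.prodAssoc κ β ε).symm σ))

/-- `I(Y;BE)` evaluated on a state of the form `σ^{Y(BE)}`. -/
def IYBE {κ β ε : Type*} [Fintype κ] [DecidableEq κ] [Fintype β] [DecidableEq β] [Fintype ε]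
    [DecidableEq ε] (σ : Matrix (κ × (β × ε)) (κ × (β × ε)) ℂ) : ℝ :=
  mutualInfo σ

/-- `P^{(1)}_→(ρ^{AB}, R) = max_Λ { I(Y;B)_σ : I(Y;BE)_σ ≤ R }`, the maximum over all
POVMs on Alice's system. -/
def P1 {α β : Type*} [Fintype α] [DecidableEq α] [Fintype β] [DecidableEq β]
    (ρ : Matrix (α × β) (α × β) ℂ) (R : ℝ) : ℝ :=
  sSup { v : ℝ | ∃ (m : ℕ) (Λ : POVM α (Fin m)),
    IYBE (sigmaOf ρ Λ) ≤ R ∧ v = IYB (sigmaOf ρ Λ) }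

/-! ### Local purity distillation protocols -/

/-- An `(n, ·, ·, ·)` local purity distillation protocol: Alice's unitary
`U_A : H_{A^n} ⊗ H_C → H_{A_p} ⊗ H_Y ⊗ H_{A_g}`, a dephasing channel on `Y`
(applied below), and Bob's unitary `U_B : H_{B^n} ⊗ H_Y → H_{B_p} ⊗ H_{B_g}`. -/
structure Protocol (α β : Type*) [Fintype α] [DecidableEq α] [Fintype β] [DecidableEq β]
    (n : ℕ) where
  dC : ℕ
  dAp : ℕ
  dY : ℕ
  dAg : ℕ
  dBp : ℕ
  dBg : ℕ
  dC_pos : 0 < dC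
  dAp_pos : 0 < dAp
  dY_pos : 0 < dY
  dAg_pos : 0 < dAg
  dBp_pos : 0 < dBp
  dBg_pos : 0 < dBg
  UA : Matrix ((Fin dAp × Fin dY) × Fin dAg) ((Fin n → α) × Fin dC) ℂ
  UA_unitary : UAᴴ * UA = 1 ∧ UA * UAᴴ = 1
  UB : Matrix (Fin dBp × Fin dBg) ((Fin n → β) × Fin dY) ℂ
  UB_unitary : UBᴴ * UB = 1 ∧ UB * UBᴴ = 1

variable {α β : Type*} [Fintype α] [DecidableEq α] [Fintype β] [DecidableEq β]

/-- The input state `(ρ^{AB})^{⊗n} ⊗ |0⟩⟨0|^C`, arranged as `(A^n × C) × B^n`. -/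
def inputState (ρ : Matrix (α × β) (α × β) ℂ) {n : ℕ} (Pr : Protocol α β n) :
    Matrix (((Fin n → α) × Fin Pr.dC) × (Fin n → β))
      (((Fin n → α) × Fin Pr.dC) × (Fin n → β)) ℂ :=
  Matrix.reindex (swapE (Fin n → α) (Fin n → β) (Fin Pr.dC))
    (swapE (Fin n → α) (Fin n → β) (Fin Pr.dC)) (tpowAB ρ n ⊗ₖ pureZero Pr.dC)

/-- The state `U_A((ρ^{AB})^{⊗n} ⊗ |0⟩⟨0|^C)` (before dephasing), on
`((A_p × Y) × A_g) × B^n`. -/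
def stateAfterUA (ρ : Matrix (α × β) (α × β) ℂ) {n : ℕ} (Pr : Protocol α β n) :
    Matrix (((Fin Pr.dAp × Fin Pr.dY) × Fin Pr.dAg) × (Fin n → β))
      (((Fin Pr.dAp × Fin Pr.dY) × Fin Pr.dAg) × (Fin n → β)) ℂ :=
  (Pr.UA ⊗ₖ (1 : Matrix (Fin n → β) (Fin n → β) ℂ)) * inputState ρ Pr *
    (Pr.UA ⊗ₖ (1 : Matrix (Fin n → β) (Fin n → β) ℂ))ᴴ

/-- Dephase the first tensor factor in a fixed basis. -/
def dephaseFst {κ γ : Type*} [DecidableEq κ] (ρ : Matrix (κ × γ) (κ × γ) ℂ) :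
    Matrix (κ × γ) (κ × γ) ℂ :=
  fun p q => if p.1 = q.1 then ρ p q else 0

/-- The state after Alice's unitary and the dephasing channel on `Y`. -/
def stateAfterDephasing (ρ : Matrix (α × β) (α × β) ℂ) {n : ℕ} (Pr : Protocol α β n) :
    Matrix (((Fin Pr.dAp × Fin Pr.dY) × Fin Pr.dAg) × (Fin n → β))
      (((Fin Pr.dAp × Fin Pr.dY) × Fin Pr.dAg) × (Fin n → β)) ℂ :=
  Matrix.reindex (pullY (Fin Pr.dAp) (Fin Pr.dY) (Fin Pr.dAg) (Fin n → β)).symm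
    (pullY (Fin Pr.dAp) (Fin Pr.dY) (Fin Pr.dAg) (Fin n → β)).symm
    (dephaseFst (Matrix.reindex (pullY (Fin Pr.dAp) (Fin Pr.dY) (Fin Pr.dAg) (Fin n → β))
      (pullY (Fin Pr.dAp) (Fin Pr.dY) (Fin Pr.dAg) (Fin n → β)) (stateAfterUA ρ Pr)))

/-- The final state `Υ`, after Bob's unitary, on `(B_p × B_g) × (A_p × A_g)`. -/
def stateAfterUB (ρ : Matrix (α × β) (α × β) ℂ) {n : ℕ} (Pr : Protocol α β n) :
    Matrix ((Fin Pr.dBp × Fin Pr.dBg) × (Fin Pr.dAp × Fin Pr.dAg))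
      ((Fin Pr.dBp × Fin Pr.dBg) × (Fin Pr.dAp × Fin Pr.dAg)) ℂ :=
  (Pr.UB ⊗ₖ (1 : Matrix (Fin Pr.dAp × Fin Pr.dAg) (Fin Pr.dAp × Fin Pr.dAg) ℂ)) *
    Matrix.reindex (pullBY (Fin Pr.dAp) (Fin Pr.dY) (Fin Pr.dAg) (Fin n → β))
      (pullBY (Fin Pr.dAp) (Fin Pr.dY) (Fin Pr.dAg) (Fin n → β)) (stateAfterDephasing ρ Pr) *
    (Pr.UB ⊗ₖ (1 : Matrix (Fin Pr.dAp × Fin Pr.dAg) (Fin Pr.dAp × Fin Pr.dAg) ℂ))ᴴ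

/-- The reduced output state `Υ^{A_p B_p}`. -/
def outputReduced (ρ : Matrix (α × β) (α × β) ℂ) {n : ℕ} (Pr : Protocol α β n) :
    Matrix (Fin Pr.dAp × Fin Pr.dBp) (Fin Pr.dAp × Fin Pr.dBp) ℂ :=
  ptraceRight (Matrix.reindex
    (sortOut (Fin Pr.dBp) (Fin Pr.dBg) (Fin Pr.dAp) (Fin Pr.dAg))
    (sortOut (Fin Pr.dBp) (Fin Pr.dBg) (Fin Pr.dAp) (Fin Pr.dAg)) (stateAfterUB ρ Pr))

/-- The error of a protocol: trace distance of `Υ^{A_p B_p}` from `|0⟩⟨0| ⊗ |0⟩⟨0|`. -/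
def protocolError (ρ : Matrix (α × β) (α × β) ℂ) {n : ℕ} (Pr : Protocol α β n) : ℝ :=
  traceNorm (outputReduced ρ Pr - pureZero Pr.dAp ⊗ₖ pureZero Pr.dBp)

/-- The classical communication rate `(1/n) log d_Y` of a protocol. -/
def commRate {n : ℕ} (Pr : Protocol α β n) : ℝ := Real.log Pr.dY / n

/-- The purity rate `(1/n)(log d_{A_p}d_{B_p} - log d_C)` of a protocol. -/
def purityRate {n : ℕ} (Pr : Protocol α β n) : ℝ :=
  (Real.log (Pr.dAp * Pr.dBp) - Real.log Pr.dC) / n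

/-- Achievability of a rate pair `(P, R)`: for all `ε, δ > 0` and all sufficiently large `n`
there is an `(n, R+δ, P-δ, ε)` protocol. -/
def Achievable (ρ : Matrix (α × β) (α × β) ℂ) (P R : ℝ) : Prop :=
  ∀ ε > (0 : ℝ), ∀ δ > (0 : ℝ), ∃ N : ℕ, ∀ n ≥ N, ∃ Pr : Protocol α β n,
    commRate Pr ≤ R + δ ∧ P - δ ≤ purityRate Pr ∧ protocolError ρ Pr ≤ ε

/-- The 1-way distillable local purity `κ_→(ρ^{AB}, R)`. -/
def kappaArrow (ρ : Matrix (α × β) (α × β) ℂ) (R : ℝ) : ℝ :=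
  sSup { P : ℝ | Achievable ρ P R }

/-- `I(Y;B^n)` on the pre-dephasing state `U_A((ρ^{AB})^{⊗n} ⊗ |0⟩⟨0|^C)`. -/
def preDephIYB (ρ : Matrix (α × β) (α × β) ℂ) {n : ℕ} (Pr : Protocol α β n) : ℝ :=
  mutualInfo (ptraceRight (Matrix.reindex
    (pullYB (Fin Pr.dAp) (Fin Pr.dY) (Fin Pr.dAg) (Fin n → β))
    (pullYB (Fin Pr.dAp) (Fin Pr.dY) (Fin Pr.dAg) (Fin n → β)) (stateAfterUA ρ Pr)))

/-- The pre-dephasing state together with the purifying environment `E^n`: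
`(U_A ⊗ 1^{B^nE^n})((Ψ^{ABE})^{⊗n} ⊗ |0⟩⟨0|^C)`, where `Ψ` is the canonical purification. -/
def preDephWithEnv (ρ : Matrix (α × β) (α × β) ℂ) {n : ℕ} (Pr : Protocol α β n) :
    Matrix (((Fin Pr.dAp × Fin Pr.dY) × Fin Pr.dAg) × (Fin n → β × (α × β)))
      (((Fin Pr.dAp × Fin Pr.dY) × Fin Pr.dAg) × (Fin n → β × (α × β))) ℂ :=
  (Pr.UA ⊗ₖ (1 : Matrix (Fin n → β × (α × β)) (Fin n → β × (α × β)) ℂ)) *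
    Matrix.reindex (swapE (Fin n → α) (Fin n → β × (α × β)) (Fin Pr.dC))
      (swapE (Fin n → α) (Fin n → β × (α × β)) (Fin Pr.dC))
      (tpowAB (purifyAssoc ρ) n ⊗ₖ pureZero Pr.dC) *
    (Pr.UA ⊗ₖ (1 : Matrix (Fin n → β × (α × β)) (Fin n → β × (α × β)) ℂ))ᴴ

/-- `I(Y;B^nE^n)` on the pre-dephasing state, including the purifying environment. -/
def preDephIYBE (ρ : Matrix (α × β) (α × β) ℂ) {n : ℕ} (Pr : Protocol α β n) : ℝ :=
  mutualInfo (ptraceRight (Matrix.reindex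
    (pullYB (Fin Pr.dAp) (Fin Pr.dY) (Fin Pr.dAg) (Fin n → β × (α × β)))
    (pullYB (Fin Pr.dAp) (Fin Pr.dY) (Fin Pr.dAg) (Fin n → β × (α × β)))
    (preDephWithEnv ρ Pr)))

/-- `H(Y)` on the pre-dephasing state. -/
def preDephHY (ρ : Matrix (α × β) (α × β) ℂ) {n : ℕ} (Pr : Protocol α β n) : ℝ :=
  entropy (ptraceRight (Matrix.reindex
    (pullY (Fin Pr.dAp) (Fin Pr.dY) (Fin Pr.dAg) (Fin n → β))
    (pullY (Fin Pr.dAp) (Fin Pr.dY) (Fin Pr.dAg) (Fin n → β)) (stateAfterUA ρ Pr)))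

/-! ### Single-party purity concentration -/

/-- An `(n, ·, ·)` purity concentration protocol: a unitary
`U : H_{A^n} → H_{A_p} ⊗ H_{A_g}`. -/
structure ConcProtocol (α : Type*) [Fintype α] [DecidableEq α] (n : ℕ) where
  dAp : ℕ
  dAg : ℕ
  dAp_pos : 0 < dAp
  dAg_pos : 0 < dAg
  U : Matrix (Fin dAp × Fin dAg) (Fin n → α) ℂ
  U_unitary : Uᴴ * U = 1 ∧ U * Uᴴ = 1

/-- The reduced state `Υ^{A_p}` of `U ρ^{⊗n} U†`. -/
def concOutput {α : Type*} [Fintype α] [DecidableEq α] (ρ : Matrix α α ℂ) {n : ℕ}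
    (Pr : ConcProtocol α n) : Matrix (Fin Pr.dAp) (Fin Pr.dAp) ℂ :=
  ptraceRight (Pr.U * tpow ρ n * Pr.Uᴴ)

/-- Achievability of a purity-concentration rate `P`. -/
def ConcAchievable {α : Type*} [Fintype α] [DecidableEq α] (ρ : Matrix α α ℂ) (P : ℝ) :
    Prop :=
  ∀ ε > (0 : ℝ), ∀ δ > (0 : ℝ), ∃ N : ℕ, ∀ n ≥ N, ∃ Pr : ConcProtocol α n,
    P - δ ≤ Real.log Pr.dAp / n ∧ traceNorm (concOutput ρ Pr - pureZero Pr.dAp) ≤ ε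

/-- The purity `κ(ρ)`: the supremum of all achievable concentration rates. -/
def kappaConc {α : Type*} [Fintype α] [DecidableEq α] (ρ : Matrix α α ℂ) : ℝ :=
  sSup { P : ℝ | ConcAchievable ρ P }

/-! ### Measurement compression -/

/-- The averaged compressed-measurement map
`σ ↦ (1/|L|) Σ_l Σ_m Tr(Λ̃^{(l)}_m σ) |f(m,l)⟩⟨f(m,l)|`, applied to the first factor. -/
def mcMap {A Ω γ' : Type*} [Fintype A] [DecidableEq A] [Fintype Ω] [DecidableEq Ω]
    (L M : ℕ) (Λt : Fin L → POVM A (Fin M)) (f : Fin M → Fin L → Ω)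
    (ρ : Matrix (A × γ') (A × γ') ℂ) : Matrix (Ω × γ') (Ω × γ') ℂ :=
  fun p q => (L : ℂ)⁻¹ * ∑ l, ∑ m, (if f m l = p.1 ∧ f m l = q.1 then 1 else 0) *
    ∑ a, ∑ a', ((Λt l).elem m) a a' * ρ (a', p.2) (a, q.2)

/-! ### Classical-quantum states and classical channels -/

/-- The classical-quantum state `Σ_x p(x) |x⟩⟨x| ⊗ ρ_x`. -/
def cqState {𝒳 B : Type*} [DecidableEq 𝒳] (p : 𝒳 → ℝ) (ρx : 𝒳 → Matrix B B ℂ) :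
    Matrix (𝒳 × B) (𝒳 × B) ℂ :=
  fun P Q => if P.1 = Q.1 then (p P.1 : ℂ) * ρx P.1 P.2 Q.2 else 0

/-- The state on `Y × (X × W)` obtained from a purification vector `ψ` of a cq state
(with classical system `X` and the rest `W`) by applying a classical channel `q(y|x)`
to the classical system: `Σ_{x,y} q(y|x) |y⟩⟨y| ⊗ |x⟩⟨x|-block of p(x)·(BE state given x)`. -/
def chanState {𝒳 W 𝒴 : Type*} [DecidableEq 𝒳] [DecidableEq 𝒴]
    (ψ : 𝒳 × W → ℂ) (q : 𝒳 → 𝒴 → ℝ) :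
    Matrix (𝒴 × (𝒳 × W)) (𝒴 × (𝒳 × W)) ℂ :=
  fun P Q => if P.1 = Q.1 ∧ P.2.1 = Q.2.1
    then (q P.2.1 P.1 : ℂ) * ψ P.2 * star (ψ Q.2) else 0

/-- The `n`-fold tensor power of a purification vector of a cq state, with the
classical, `B` and `E` registers collected. -/
def vecPowBE {𝒳 B E : Type*} (ψ : 𝒳 × (B × E) → ℂ) (n : ℕ) :
    (Fin n → 𝒳) × ((Fin n → B) × (Fin n → E)) → ℂ :=
  fun xw => ∏ k, ψ (xw.1 k, (xw.2.1 k, xw.2.2 k))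

variable {𝒴' 𝒳 B E : Type*} [Fintype 𝒴'] [DecidableEq 𝒴'] [Fintype 𝒳] [DecidableEq 𝒳]
  [Fintype B] [DecidableEq B] [Fintype E] [DecidableEq E]

/-- `I(Y;B)` on a state of the form `τ^{Y(X(BE))}`. -/
def miYB (τ : Matrix (𝒴' × (𝒳 × (B × E))) (𝒴' × (𝒳 × (B × E))) ℂ) : ℝ :=
  mutualInfo (ptraceRight (Matrix.reindex (exYB 𝒴' 𝒳 B E) (exYB 𝒴' 𝒳 B E) τ))

/-- `I(Y;BE)` on a state of the form `τ^{Y(X(BE))}`. -/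
def miYBE (τ : Matrix (𝒴' × (𝒳 × (B × E))) (𝒴' × (𝒳 × (B × E))) ℂ) : ℝ :=
  mutualInfo (ptraceRight (Matrix.reindex (exYW 𝒴' 𝒳 (B × E)) (exYW 𝒴' 𝒳 (B × E)) τ))

/-- `I(Y;X)` on a state of the form `τ^{Y(X(BE))}`. -/
def miYX (τ : Matrix (𝒴' × (𝒳 × (B × E))) (𝒴' × (𝒳 × (B × E))) ℂ) : ℝ :=
  mutualInfo (ptraceRight (Matrix.reindex (exYX 𝒴' 𝒳 (B × E)) (exYX 𝒴' 𝒳 (B × E)) τ))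

/-- A classical channel: entrywise nonnegative with rows summing to one. -/
def IsChannel {X Y : Type*} [Fintype Y] (q : X → Y → ℝ) : Prop :=
  (∀ x y, 0 ≤ q x y) ∧ ∀ x, ∑ y, q x y = 1

/-- `P_n(R) = max_{Y|X^n} { (1/n) I(Y;B^n) : (1/n) I(Y;B^nE^n) ≤ R }` for a cq state
with purification vector `ψ`. -/
def Pn (ψ : 𝒳 × (B × E) → ℂ) (n : ℕ) (R : ℝ) : ℝ :=
  sSup { v : ℝ | ∃ (m : ℕ) (q : (Fin n → 𝒳) → Fin m → ℝ), IsChannel q ∧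
    (1 / n : ℝ) * miYBE (chanState (vecPowBE ψ n) q) ≤ R ∧
    v = (1 / n : ℝ) * miYB (chanState (vecPowBE ψ n) q) }

/-- `D_n(R) = max_{Y|X^n} { (1/n) I(Y;B^n) : (1/n)(I(Y;X^n) - I(Y;B^n)) ≤ R }` for a cq
state with purification vector `ψ`. -/
def Dn (ψ : 𝒳 × (B × E) → ℂ) (n : ℕ) (R : ℝ) : ℝ :=
  sSup { v : ℝ | ∃ (m : ℕ) (q : (Fin n → 𝒳) → Fin m → ℝ), IsChannel q ∧
    (1 / n : ℝ) * (miYX (chanState (vecPowBE ψ n) q)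
      - miYB (chanState (vecPowBE ψ n) q)) ≤ R ∧
    v = (1 / n : ℝ) * miYB (chanState (vecPowBE ψ n) q) }

/-! ### Quantum channels -/

/-- A completely positive trace-preserving map between matrix algebras. -/
structure CPTP (ι κ : Type*) [Fintype ι] [DecidableEq ι] [Fintype κ] [DecidableEq κ] where
  map : Matrix ι ι ℂ →ₗ[ℂ] Matrix κ κ ℂ
  trace_preserving : ∀ ρ, (map ρ).trace = ρ.trace
  completely_positive : ∀ (n : ℕ) (ρ : Matrix (ι × Fin n) (ι × Fin n) ℂ), ρ.PosSemidef →
    (Matrix.of fun p q : κ × Fin n =>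
      map (Matrix.of fun i i' => ρ (i, p.2) (i', q.2)) p.1 q.1).PosSemidef

lemma entropy_eq_roots {ι : Type*} [Fintype ι] [DecidableEq ι] (ρ : Matrix ι ι ℂ)
    (h : ρ.IsHermitian) :
    entropy ρ = -(ρ.charpoly.roots.map (fun z : ℂ => z.re * Real.log z.re)).sum := by
  unfold entropy
  rw [dif_pos h, h.roots_charpoly_eq_eigenvalues]
  rw [Multiset.map_map]
  rfl

lemma entropy_mul_comm {ι κ : Type*} [Fintype ι] [DecidableEq ι] [Fintype κ] [DecidableEq κ]
    (M : Matrix ι κ ℂ) : entropy (M * Mᴴ) = entropy (Mᴴ * M) := by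
  rw [entropy_eq_roots _ (isHermitian_mul_conjTranspose_self M),
    entropy_eq_roots _ (isHermitian_conjTranspose_mul_self M)]
  have h := congrArg (fun f : Polynomial ℂ =>
    (f.roots.map (fun z : ℂ => z.re * Real.log z.re)).sum) (charpoly_mul_comm' M Mᴴ)
  have hX : ∀ k : ℕ, (Polynomial.X ^ k : Polynomial ℂ) ≠ 0 := fun k =>
    pow_ne_zero _ Polynomial.X_ne_zero
  rw [Polynomial.roots_mul (mul_ne_zero (hX _) (charpoly_monic _).ne_zero),
    Polynomial.roots_mul (mul_ne_zero (hX _) (charpoly_monic _).ne_zero)] at h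
  simpa [Multiset.nsmul_singleton] using h

lemma entropy_reindex {ι κ : Type*} [Fintype ι] [DecidableEq ι] [Fintype κ] [DecidableEq κ]
    (e : ι ≃ κ) (ρ : Matrix ι ι ℂ) : entropy (Matrix.reindex e e ρ) = entropy ρ := by
  by_cases h : ρ.IsHermitian
  · have h' : (Matrix.reindex e e ρ).IsHermitian := h.submatrix _
    rw [entropy_eq_roots _ h, entropy_eq_roots _ h', charpoly_reindex]
  · have h' : ¬ (Matrix.reindex e e ρ).IsHermitian := by
      intro h'
      apply h
      have := h'.submatrix e
      simpa using this
    unfold entropy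
    rw [dif_neg h, dif_neg h']

lemma entropy_diagonal {ι : Type*} [Fintype ι] [DecidableEq ι] (d : ι → ℝ) :
    entropy (diagonal (fun i => (d i : ℂ))) = -∑ i, d i * Real.log (d i) := by
  have h : (diagonal (fun i => (d i : ℂ))).IsHermitian := by
    ext i j
    by_cases hij : i = j
    · subst hij; simp [conjTranspose_apply]
    · simp [conjTranspose_apply, hij, Ne.symm hij]
  rw [entropy_eq_roots _ h, charpoly_diagonal, Polynomial.roots_prod]
  · simp [Multiset.map_bind, Multiset.sum_bind]
  · simp [Finset.prod_ne_zero_iff, Polynomial.X_sub_C_ne_zero]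

lemma charpoly_blockDiagonal' {κ β : Type*} [Fintype κ] [DecidableEq κ] [Fintype β]
    [DecidableEq β] (S : κ → Matrix β β ℂ) :
    (blockDiagonal S).charpoly = ∏ y, (S y).charpoly := by
  unfold Matrix.charpoly
  rw [← det_blockDiagonal]
  congr 1
  ext ⟨i, k⟩ ⟨j, k'⟩
  by_cases hk : k = k'
  · subst hk
    by_cases hij : i = j
    · subst hij; simp [charmatrix_apply, blockDiagonal_apply]
    · simp [charmatrix_apply, blockDiagonal_apply, hij]
  · simp [charmatrix_apply, blockDiagonal_apply, hk]

lemma entropy_block {κ β : Type*} [Fintype κ] [DecidableEq κ] [Fintype β]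
    [DecidableEq β] (S : κ → Matrix β β ℂ) (hS : ∀ y, (S y).IsHermitian)
    (τ : Matrix (κ × β) (κ × β) ℂ)
    (hτ : ∀ y b y' b', τ (y, b) (y', b') = if y = y' then S y b b' else 0) :
    entropy τ = ∑ y, entropy (S y) := by
  have h1 : τ = Matrix.reindex (Equiv.prodComm β κ) (Equiv.prodComm β κ) (blockDiagonal S) := by
    ext ⟨y, b⟩ ⟨y', b'⟩
    simp [hτ, blockDiagonal_apply]
  have h2 : (blockDiagonal S).IsHermitian := by
    unfold Matrix.IsHermitian
    rw [blockDiagonal_conjTranspose]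
    congr 1
    funext y
    exact hS y
  rw [h1, entropy_reindex, entropy_eq_roots _ h2, charpoly_blockDiagonal', Polynomial.roots_prod]
  · rw [Multiset.map_bind, Multiset.sum_bind]
    simp [fun y => entropy_eq_roots _ (hS y)]
  · simp [Finset.prod_ne_zero_iff, (charpoly_monic _).ne_zero]

lemma entropy_ge_trace {β : Type*} [Fintype β] [DecidableEq β] (S : Matrix β β ℂ)
    (hS : S.PosSemidef) : -(S.trace.re * Real.log S.trace.re) ≤ entropy S := by
  unfold entropy
  rw [dif_pos hS.1, hS.1.trace_eq_sum_eigenvalues, neg_le_neg_iff]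
  have : (∑ i, ((hS.1.eigenvalues i : ℝ) : ℂ)).re = ∑ i, hS.1.eigenvalues i := by simp
  have h2 : (∑ i, (RCLike.ofReal (hS.1.eigenvalues i) : ℂ)).re = ∑ i, hS.1.eigenvalues i := this
  rw [h2, Finset.sum_mul]
  apply Finset.sum_le_sum
  intro i _
  have h0 := hS.eigenvalues_nonneg i
  rcases h0.eq_or_lt with h | h
  · rw [← h]; simp
  · apply mul_le_mul_of_nonneg_left _ h0
    exact Real.log_le_log h
      (Finset.single_le_sum (fun j _ => hS.eigenvalues_nonneg j) (Finset.mem_univ i))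

lemma mutualInfo_block_le {κ β : Type*} [Fintype κ] [DecidableEq κ] [Fintype β]
    [DecidableEq β] (S : κ → Matrix β β ℂ) (hS : ∀ y, (S y).PosSemidef)
    (τ : Matrix (κ × β) (κ × β) ℂ)
    (hτ : ∀ y b y' b', τ (y, b) (y', b') = if y = y' then S y b b' else 0) :
    mutualInfo τ ≤ entropy (ptraceLeft τ) := by
  unfold mutualInfo
  rw [entropy_block S (fun y => (hS y).1) τ hτ]
  have h1 : ptraceRight τ = diagonal (fun y => (((S y).trace.re : ℝ) : ℂ)) := by
    ext y y'
    by_cases hy : y = y'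
    · subst hy
      have h3 : ((S y).trace.re : ℂ) = (S y).trace := by
        have := (hS y).trace_nonneg
        rw [Complex.le_def] at this
        apply Complex.ext <;> simp
        exact this.2
      simp only [diagonal_apply_eq]
      rw [h3]
      simp [ptraceRight, hτ, Matrix.trace]
    · simp [ptraceRight, hτ, hy]
  rw [h1, entropy_diagonal, ← Finset.sum_neg_distrib]
  have := Finset.sum_le_sum (fun y (_ : y ∈ Finset.univ) => entropy_ge_trace (S y) (hS y))
  linarith

lemma miYB_le {κ X B E : Type*} [Fintype κ] [DecidableEq κ] [Fintype X] [DecidableEq X]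
    [Fintype B] [DecidableEq B] [Fintype E] [DecidableEq E]
    (φ : X × (B × E) → ℂ) (q : X → κ → ℝ) (hq : IsChannel q) :
    miYB (chanState φ q) ≤
      entropy (fun b b' : B => ∑ x, ∑ e, φ (x, (b, e)) * star (φ (x, (b', e)))) := by
  unfold miYB
  have key := mutualInfo_block_le (κ := κ) (β := B)
    (fun y => ∑ x, ∑ e, (q x y : ℂ) • vecMulVec (fun b => φ (x, (b, e)))
      (star (fun b => φ (x, (b, e)))))
    (fun y => by
      apply Matrix.posSemidef_sum
      intro x _
      apply Matrix.posSemidef_sum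
      intro e _
      apply Matrix.PosSemidef.smul (posSemidef_vecMulVec_self_star _)
      exact_mod_cast hq.1 x y)
    (ptraceRight (Matrix.reindex (exYB κ X B E) (exYB κ X B E) (chanState φ q)))
    (by
      intro y b y' b'
      by_cases hy : y = y'
      · subst hy
        simp [ptraceRight, exYB, chanState, Matrix.sum_apply, Fintype.sum_prod_type,
          vecMulVec_apply, mul_assoc]
      · simp [ptraceRight, exYB, chanState, hy])
  refine key.trans (le_of_eq ?_)
  congr 1
  ext b b'
  simp only [ptraceLeft, ptraceRight, Matrix.reindex_apply, Matrix.submatrix_apply, exYB,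
    chanState, Fintype.sum_prod_type, Equiv.coe_fn_symm_mk, and_self, if_true]
  rw [Finset.sum_comm]
  refine Finset.sum_congr rfl fun x _ => ?_
  rw [Finset.sum_comm]
  refine Finset.sum_congr rfl fun e _ => ?_
  simp only [mul_assoc]
  rw [← Finset.sum_mul]
  have := hq.2 x
  rw [← Complex.ofReal_sum, this]
  simp

lemma miYBE_eq_miYX {κ X B E : Type*} [Fintype κ] [DecidableEq κ] [Fintype X] [DecidableEq X]
    [Fintype B] [DecidableEq B] [Fintype E] [DecidableEq E]
    (φ : X × (B × E) → ℂ) (q : X → κ → ℝ) (hq : IsChannel q)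
    (ho : ∀ x x', x ≠ x' → ∑ w, star (φ (x, w)) * φ (x', w) = 0) :
    miYBE (chanState φ q) = miYX (chanState φ q) := by
  have hs : ∀ x y, ((Real.sqrt (q x y) : ℝ) : ℂ) * ((Real.sqrt (q x y) : ℝ) : ℂ) = q x y := by
    intro x y
    rw [← Complex.ofReal_mul, Real.mul_self_sqrt (hq.1 x y)]
  have hsum : ∀ x, ∑ y, (q x y : ℂ) = 1 := by
    intro x
    rw [← Complex.ofReal_sum, hq.2 x]; simp
  unfold miYBE miYX mutualInfo
  have hY : ptraceRight (ptraceRight (Matrix.reindex (exYW κ X (B × E)) (exYW κ X (B × E))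
      (chanState φ q))) = ptraceRight (ptraceRight (Matrix.reindex (exYX κ X (B × E))
        (exYX κ X (B × E)) (chanState φ q))) := by
    ext y y'
    simp only [ptraceRight, Matrix.reindex_apply, Matrix.submatrix_apply, exYW, exYX,
      Equiv.coe_fn_symm_mk]
    rw [Finset.sum_comm]
  obtain ⟨M, hM⟩ : ∃ M : Matrix (κ × (B × E)) (κ × X) ℂ, ∀ a b, M a b =
    if a.1 = b.1 then ((Real.sqrt (q b.2 b.1) : ℝ) : ℂ) * φ (b.2, a.2) else 0 :=
    ⟨fun a b => _, fun _ _ => rfl⟩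
  obtain ⟨N, hN⟩ : ∃ N : Matrix (B × E) X ℂ, ∀ w x, N w x = φ (x, w) :=
    ⟨fun w x => _, fun _ _ => rfl⟩
  have h1 : ptraceRight (Matrix.reindex (exYW κ X (B × E)) (exYW κ X (B × E))
      (chanState φ q)) = M * Mᴴ := by
    ext ⟨y, w⟩ ⟨y', w'⟩
    simp only [ptraceRight, Matrix.reindex_apply, Matrix.submatrix_apply, exYW,
      Equiv.coe_fn_symm_mk, Matrix.mul_apply, hM, conjTranspose_apply, chanState,
      Fintype.sum_prod_type]
    by_cases hy : y = y'
    · subst hy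
      simp only [ite_mul, zero_mul]
      rw [Finset.sum_eq_single y]
      · refine Finset.sum_congr rfl fun x _ => ?_
        simp only [and_self, if_true, star_mul']
        rw [← hs x y]
        simp
        ring
      · intro y2 _ h2
        simp [Ne.symm h2]
      · simp
    · simp only [hy, false_and, if_false, Finset.sum_const_zero]
      symm
      refine Finset.sum_eq_zero fun y2 _ => Finset.sum_eq_zero fun x _ => ?_
      by_cases h2 : y = y2
      · subst h2; simp [Ne.symm hy]
      · simp [h2]
  have h2 : ptraceRight (Matrix.reindex (exYX κ X (B × E)) (exYX κ X (B × E))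
      (chanState φ q)) = Mᴴ * M := by
    ext ⟨y, x⟩ ⟨y', x'⟩
    rw [Matrix.mul_apply, Fintype.sum_prod_type]
    simp only [ptraceRight, Matrix.reindex_apply, Matrix.submatrix_apply, exYX,
      Equiv.coe_fn_symm_mk, hM, conjTranspose_apply, chanState]
    by_cases hy : y = y'
    · subst hy
      rw [Finset.sum_eq_single y]
      · by_cases hx : x = x'
        · subst hx
          refine Finset.sum_congr rfl fun w _ => ?_
          simp only [and_self, if_true, star_mul']
          rw [← hs x y]
          simp
          ring
        · simp only [hx, and_false, if_false, Finset.sum_const_zero, if_true, star_mul']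
          have := ho x x' hx
          calc (0 : ℂ) = star ((Real.sqrt (q x y) : ℝ) : ℂ) * ((Real.sqrt (q x' y) : ℝ) : ℂ) *
                ∑ w, star (φ (x, w)) * φ (x', w) := by rw [this, mul_zero]
            _ = _ := by
              rw [Finset.mul_sum]
              refine Finset.sum_congr rfl fun w _ => ?_
              ring
      · intro y2 _ h2
        simp [h2]
      · simp
    · simp only [hy, false_and, if_false, Finset.sum_const_zero]
      symm
      refine Finset.sum_eq_zero fun y2 _ => Finset.sum_eq_zero fun x _ => ?_
      by_cases h2 : y2 = y
      · subst h2; simp [hy]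
      · simp [h2]
  have h3 : ptraceLeft (M * Mᴴ) = N * Nᴴ := by
    rw [← h1]
    ext w w'
    simp only [ptraceLeft, ptraceRight, Matrix.reindex_apply, Matrix.submatrix_apply, exYW,
      Equiv.coe_fn_symm_mk, Matrix.mul_apply, hN, conjTranspose_apply, chanState, and_self,
      if_true]
    rw [Finset.sum_comm]
    refine Finset.sum_congr rfl fun x _ => ?_
    simp only [mul_assoc]
    rw [← Finset.sum_mul, hsum, one_mul]
  have h4 : ptraceLeft (Mᴴ * M) = Nᴴ * N := by
    rw [← h2]
    ext x x'
    simp only [ptraceLeft, ptraceRight, Matrix.reindex_apply, Matrix.submatrix_apply, exYX,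
      Equiv.coe_fn_symm_mk, Matrix.mul_apply, hN, conjTranspose_apply, chanState, true_and]
    by_cases hx : x = x'
    · subst hx
      simp only [if_true]
      rw [Finset.sum_comm]
      refine Finset.sum_congr rfl fun w _ => ?_
      simp only [mul_assoc]
      rw [← Finset.sum_mul, hsum, one_mul, mul_comm]
    · rw [ho x x' hx]
      simp [hx]
  rw [hY, h1, h2, h3, h4, entropy_mul_comm M, entropy_mul_comm N]

lemma vecPow_orth {X B E : Type*} [Fintype B] [Fintype E]
    (ψ : X × (B × E) → ℂ) (ho : ∀ x x', x ≠ x' → ∑ w, star (ψ (x, w)) * ψ (x', w) = 0) (n : ℕ)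
    (x x' : Fin n → X) (hx : x ≠ x') :
    ∑ w, star (vecPowBE ψ n (x, w)) * vecPowBE ψ n (x', w) = 0 := by
  classical
  obtain ⟨k, hk⟩ := Function.ne_iff.mp hx
  rw [← (Equiv.arrowProdEquivProdArrow (Fin n) (fun _ => B) (fun _ => E)).sum_comp]
  have h := Finset.prod_univ_sum (fun _ : Fin n => (Finset.univ : Finset (B × E)))
    (fun k w => star (ψ (x k, w)) * ψ (x' k, w))
  rw [Fintype.piFinset_univ] at h
  rw [Finset.prod_eq_zero (Finset.mem_univ k) (ho _ _ hk)] at h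
  rw [h]
  refine Finset.sum_congr rfl fun w _ => ?_
  simp [vecPowBE, Finset.prod_mul_distrib, Equiv.arrowProdEquivProdArrow]

lemma mutualInfo_unique {κ β : Type*} [Fintype κ] [DecidableEq κ] [Unique κ] [Fintype β]
    [DecidableEq β] (τ : Matrix (κ × β) (κ × β) ℂ) :
    mutualInfo τ = entropy (ptraceRight τ) := by
  unfold mutualInfo
  have : ptraceLeft τ = Matrix.reindex (Equiv.uniqueProd β κ) (Equiv.uniqueProd β κ) τ := by
    ext b b'
    simp [ptraceLeft, Equiv.uniqueProd]
  rw [this, entropy_reindex]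
  ring

lemma miYX_eq_miYB_unique {κ X B E : Type*} [Fintype κ] [DecidableEq κ] [Unique κ] [Fintype X]
    [DecidableEq X] [Fintype B] [DecidableEq B] [Fintype E] [DecidableEq E]
    (τ : Matrix (κ × (X × (B × E))) (κ × (X × (B × E))) ℂ) : miYX τ = miYB τ := by
  unfold miYX miYB
  rw [mutualInfo_unique, mutualInfo_unique]
  congr 1
  ext y y'
  simp only [ptraceRight, Matrix.reindex_apply, Matrix.submatrix_apply, exYX, exYB,
    Equiv.coe_fn_symm_mk, Fintype.sum_prod_type]
  rw [Finset.sum_comm]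

/-- **Relation between bounded-communication purity and common randomness distillation.**
For a classical-quantum state with purification vector `ψ`,
`P_n(D_n(R) + R) = D_n(R)` for all `R ≥ 0` and all `n ≥ 1`. -/
theorem Pn_Dn_relation {𝒳 B E : Type*} [Fintype 𝒳] [DecidableEq 𝒳] [Fintype B]
    [DecidableEq B] [Fintype E] [DecidableEq E]
    (p : 𝒳 → ℝ) (hp : ∀ x, 0 ≤ p x) (hp1 : ∑ x, p x = 1)
    (ρx : 𝒳 → Matrix B B ℂ) (hρx : ∀ x, IsDensity (ρx x))
    (ψ : 𝒳 × (B × E) → ℂ) (hψ : star ψ ⬝ᵥ ψ = 1)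
    (hpur : ptraceRight (Matrix.reindex (Equiv.prodAssoc 𝒳 B E).symm
      (Equiv.prodAssoc 𝒳 B E).symm (vecMulVec ψ (star ψ))) = cqState p ρx)
    (R : ℝ) (hR : 0 ≤ R) (n : ℕ) (hn : 1 ≤ n) :
    Pn ψ n (Dn ψ n R + R) = Dn ψ n R := by
  have ho : ∀ x x', x ≠ x' → ∑ w, star (ψ (x, w)) * ψ (x', w) = 0 := by
    intro x x' hx
    rw [Fintype.sum_prod_type]
    refine Finset.sum_eq_zero fun b _ => ?_
    have h := congrFun (congrFun hpur (x', b)) (x, b)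
    simp only [ptraceRight, cqState, Ne.symm hx, if_false, Matrix.reindex_apply,
      Matrix.submatrix_apply, vecMulVec_apply] at h
    rw [← h]
    refine Finset.sum_congr rfl fun e _ => ?_
    rw [mul_comm]
    rfl
  have hX : ∀ (m : ℕ) (q : (Fin n → 𝒳) → Fin m → ℝ), IsChannel q →
      miYBE (chanState (vecPowBE ψ n) q) = miYX (chanState (vecPowBE ψ n) q) :=
    fun m q hq => miYBE_eq_miYX _ q hq (vecPow_orth ψ ho n)
  have hn0 : (0 : ℝ) ≤ 1 / n := by positivity
  have hbdD : BddAbove { v : ℝ | ∃ (m : ℕ) (q : (Fin n → 𝒳) → Fin m → ℝ), IsChannel q ∧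
      (1 / n : ℝ) * (miYX (chanState (vecPowBE ψ n) q)
        - miYB (chanState (vecPowBE ψ n) q)) ≤ R ∧
      v = (1 / n : ℝ) * miYB (chanState (vecPowBE ψ n) q) } := by
    refine ⟨(1 / n : ℝ) * entropy (fun b b' : Fin n → B => ∑ x, ∑ e,
      vecPowBE ψ n (x, (b, e)) * star (vecPowBE ψ n (x, (b', e)))), ?_⟩
    · rintro v ⟨m, q, hq, -, rfl⟩
      exact mul_le_mul_of_nonneg_left (miYB_le _ q hq) hn0
  obtain ⟨q1, hq1⟩ : ∃ q : (Fin n → 𝒳) → Fin 1 → ℝ, IsChannel q :=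
    ⟨fun _ _ => 1, fun _ _ => zero_le_one, fun _ => by simp⟩
  have hD1 : (1 / n : ℝ) * miYB (chanState (vecPowBE ψ n) q1) ≤ Dn ψ n R :=
    le_csSup hbdD ⟨1, q1, hq1, by rw [miYX_eq_miYB_unique]; simpa using hR, rfl⟩
  have hub : ∀ (m : ℕ) (q : (Fin n → 𝒳) → Fin m → ℝ), IsChannel q →
      (1 / n : ℝ) * miYBE (chanState (vecPowBE ψ n) q) ≤ Dn ψ n R + R →
      (1 / n : ℝ) * miYB (chanState (vecPowBE ψ n) q) ≤ Dn ψ n R := by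
    intro m q hq h
    by_contra! hlt
    rw [hX m q hq] at h
    refine absurd (le_csSup hbdD ⟨m, q, hq, ?_, rfl⟩) (not_le.mpr hlt)
    rw [mul_sub]
    linarith
  apply le_antisymm
  · apply csSup_le
    · refine ⟨_, 1, q1, hq1, ?_, rfl⟩
      rw [hX 1 q1 hq1, miYX_eq_miYB_unique]
      linarith
    · rintro v ⟨m, q, hq, h, rfl⟩
      exact hub m q hq h
  · apply csSup_le
    · exact ⟨_, 1, q1, hq1, by rw [miYX_eq_miYB_unique]; simpa using hR, rfl⟩
    · rintro v ⟨m, q, hq, h, rfl⟩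
      have hv := le_csSup hbdD ⟨m, q, hq, h, rfl⟩
      refine le_csSup ⟨Dn ψ n R, ?_⟩ ⟨m, q, hq, ?_, rfl⟩
      · rintro v ⟨m, q, hq, h, rfl⟩
        exact hub m q hq h
      · rw [hX m q hq]
        rw [mul_sub] at h
        change _ ≤ Dn ψ n R at hv
        linarith

end LPD
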